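/- arXiv:1507.02401 — 5 statements merged into one kernel-verified Lean document; each statement's English description precedes it below -/
import Mathlib

section
/- Let p be a prime and G a finite group. Suppose G₀ ≤ G is a subgroup whose index [G:G₀] is a power of p, that p divides the order of G₀, and that G contains a strongly p-embedded subgroup. Then G₀ contains a strongly p-embedded subgroup. -/
/-- A subgroup `H` of a finite group `G` is *strongly `p`-embedded* if it is proper,
`p` divides its order, and for every `x ∈ G \ H` the order of `H ∩ xHx⁻¹` is prime to `p`. -/
def IsStronglyPEmbedded (p : ℕ) {G : Type*} [Group G] (H : Subgroup G) : Prop :=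
  H < ⊤ ∧ p ∣ Nat.card H ∧
    ∀ x : G, x ∉ H →
      (Nat.card ↥(H ⊓ Subgroup.map (MulAut.conj x).toMonoidHom H)).Coprime p

/-- The index of a strongly `p`-embedded subgroup `H` is `1` modulo `p`, because an element of order
`p` in `H` fixes exactly one coset in `G ⧸ H`. -/
theorem IsStronglyPEmbedded.index_modEq_one {p : ℕ} (hp : p.Prime) {G : Type*} [Group G] [Finite G]
    {H : Subgroup G} (hH : IsStronglyPEmbedded p H) : H.index ≡ 1 [MOD p] := by
  have : Fact p.Prime := ⟨hp⟩
  obtain ⟨-, hdvd, hcop⟩ := hH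
  obtain ⟨a, ha⟩ := exists_prime_orderOf_dvd_card' p hdvd
  have ha' : orderOf (a : G) = p := by rw [Subgroup.orderOf_coe, ha]
  have hP : IsPGroup p (Subgroup.zpowers (a : G)) :=
    IsPGroup.of_card (n := 1) (by rw [Nat.card_zpowers, ha', pow_one])
  have hfix : MulAction.fixedPoints (Subgroup.zpowers (a : G)) (G ⧸ H) = {((1 : G) : G ⧸ H)} := by
    ext q
    induction q using QuotientGroup.induction_on with
    | H g =>
    rw [Set.mem_singleton_iff, MulAction.mem_fixedPoints]
    constructor
    · intro h
      have hg : (((a : G) * g : G) : G ⧸ H) = g := h ⟨a, Subgroup.mem_zpowers _⟩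
      have hg' : g⁻¹ * a * g ∈ H := by
        have := QuotientGroup.eq.mp hg.symm
        rwa [← mul_assoc] at this
      rw [eq_comm, QuotientGroup.eq, inv_one, one_mul]
      by_contra hgH
      have hmem : (a : G) ∈ H ⊓ Subgroup.map (MulAut.conj g).toMonoidHom H :=
        ⟨a.2, g⁻¹ * a * g, hg', by simp [mul_assoc]⟩
      exact hp.coprime_iff_not_dvd.mp (hcop g hgH).symm
        (ha' ▸ Subgroup.orderOf_dvd_natCard _ hmem)
    · intro h
      rw [h]
      rintro ⟨b, hb⟩
      have hbH : b ∈ H := (Subgroup.zpowers_le.mpr a.2) hb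
      change ((b * 1 : G) : G ⧸ H) = _
      rw [eq_comm, QuotientGroup.eq]
      simpa using hbH
  have hmod := hP.card_modEq_card_fixedPoints (G ⧸ H)
  rw [hfix, Nat.card_coe_set_eq, Set.ncard_singleton] at hmod
  exact hmod

theorem Subgroup.relIndex_eq_index_of_coprime {G : Type*} [Group G] [Finite G] {H K : Subgroup G}
    (h : H.index.Coprime K.index) : H.relIndex K = H.index := by
  have hprod : H.relIndex K * K.index = (H ⊓ K).index := by
    rw [← Subgroup.inf_relIndex_right, Subgroup.relIndex_mul_index inf_le_right]
  apply le_antisymm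
  · refine Nat.le_of_mul_le_mul_right ?_ (Nat.pos_of_ne_zero K.index_ne_zero_of_finite)
    exact hprod ▸ Subgroup.index_inf_le
  · have hpos : 0 < H.relIndex K :=
      Nat.pos_of_ne_zero (Subgroup.index_ne_zero_of_finite (H := H.subgroupOf K))
    refine Nat.le_of_dvd hpos (h.dvd_of_dvd_mul_right ?_)
    exact hprod ▸ Subgroup.index_dvd_of_le inf_le_left

theorem subgroup_of_p_power_index_has_strongly_p_embedded
    (p : ℕ) (hp : p.Prime) (G : Type*) [Group G] [Finite G] (G₀ : Subgroup G)
    (hidx : ∃ k : ℕ, G₀.index = p ^ k) (hdvd : p ∣ Nat.card G₀)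
    (hG : ∃ H : Subgroup G, IsStronglyPEmbedded p H) :
    ∃ H₀ : Subgroup G₀, IsStronglyPEmbedded p H₀ := by
  obtain ⟨k, hk⟩ := hidx
  obtain ⟨H, hH⟩ := hG
  have hcop : H.index.Coprime p := by
    rw [Nat.Coprime, (hH.index_modEq_one hp).gcd_eq, Nat.gcd_one_left]
  have hrel : H.relIndex G₀ = H.index :=
    Subgroup.relIndex_eq_index_of_coprime (hk ▸ hcop.pow_right k)
  refine ⟨H.subgroupOf G₀, ?_, ?_, ?_⟩
  · rw [lt_top_iff_ne_top, Ne, ← Subgroup.index_eq_one]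
    change H.relIndex G₀ ≠ 1
    rw [hrel, Ne, Subgroup.index_eq_one]
    exact hH.1.ne
  · rw [← (H.subgroupOf G₀).card_mul_index] at hdvd
    change p ∣ _ * H.relIndex G₀ at hdvd
    rw [hrel] at hdvd
    exact hcop.symm.dvd_of_dvd_mul_right hdvd
  · intro x hx
    refine Nat.Coprime.coprime_dvd_left ?_ (hH.2.2 x hx)
    rw [← Subgroup.card_map_of_injective G₀.subtype_injective]
    refine Subgroup.card_dvd_of_le ?_
    rintro _ ⟨y, ⟨hy, z, hz, rfl⟩, rfl⟩
    exact ⟨hy, z, hz, by simp⟩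
end

section
/- Let p be a prime, G a finite group, H a strongly p-embedded subgroup of G that contains a Sylow p-subgroup of G, and G₀ ≤ G a subgroup whose index [G:G₀] is a power of p and such that p divides the order of G₀. Then G₀ ∩ H is a strongly p-embedded subgroup of G₀. -/
theorem inter_strongly_p_embedded
    (p : ℕ) (hp : p.Prime) (G : Type*) [Group G] [Finite G]
    (H : Subgroup G) (hH : IsStronglyPEmbedded p H)
    (hSyl : ∃ P : Sylow p G, (P : Subgroup G) ≤ H)
    (G₀ : Subgroup G) (hidx : ∃ k : ℕ, G₀.index = p ^ k) (hdvd : p ∣ Nat.card G₀) :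
    IsStronglyPEmbedded p (H.subgroupOf G₀) := by
  have : Fact p.Prime := ⟨hp⟩
  obtain ⟨hlt, -, hinter⟩ := hH
  obtain ⟨P, hP⟩ := hSyl
  obtain ⟨k, hk⟩ := hidx
  have hpH : ¬ p ∣ H.index := fun h => P.not_dvd_index (h.trans (Subgroup.index_dvd_of_le hP))
  have hcop : Nat.Coprime H.index G₀.index :=
    hk ▸ (Nat.Coprime.pow_left k ((Nat.Prime.coprime_iff_not_dvd hp).2 hpH)).symm
  refine ⟨lt_top_iff_ne_top.2 fun htop => ?_, ?_, fun x hx => ?_⟩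
  · have hdiv : H.index ∣ G₀.index :=
      Subgroup.index_dvd_of_le (Subgroup.subgroupOf_eq_top.1 htop)
    exact hlt.ne (Subgroup.index_eq_one.1 (hcop.eq_one_of_dvd hdiv))
  · have hrel : H.relIndex G₀ = H.index := by
      have hmul : H.relIndex G₀ * G₀.index = (H ⊓ G₀).index := by
        rw [← Subgroup.inf_relIndex_right, Subgroup.relIndex_mul_index inf_le_right]
      refine le_antisymm (Nat.le_of_mul_le_mul_right (hmul ▸ Subgroup.index_inf_le)
        (Nat.pos_of_ne_zero Subgroup.FiniteIndex.index_ne_zero)) ?_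
      refine Nat.le_of_dvd (Nat.pos_of_ne_zero Subgroup.FiniteIndex.index_ne_zero) ?_
      exact hcop.dvd_of_dvd_mul_right (hmul ▸ Subgroup.index_dvd_of_le inf_le_left)
    have hcard : Nat.card (H.subgroupOf G₀) * H.index = Nat.card G₀ := by
      rw [← hrel]; exact Subgroup.card_mul_index _
    exact (hp.dvd_mul.1 (hcard ▸ hdvd)).resolve_right hpH
  · refine (hinter x fun h => hx (Subgroup.mem_subgroupOf.2 h)).coprime_dvd_left ?_
    rw [← Subgroup.card_map_of_injective G₀.subtype_injective]
    refine Subgroup.card_dvd_of_le ?_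
    rintro _ ⟨y, ⟨hy, z, hz, rfl⟩, rfl⟩
    exact ⟨hy, z, hz, rfl⟩
end

section
/- Let p be a prime and G₁, G₂ finite groups such that p divides |G₁| and p divides |G₂|. Then the direct product G₁ × G₂ contains no strongly p-embedded subgroup. -/
/-- A strongly `p`-embedded subgroup contains the centralizer of each of its elements of
order `p`. -/
theorem IsStronglyPEmbedded.mem_of_commute {p : ℕ} (hp : p.Prime) {G : Type*} [Group G]
    {H : Subgroup G} (hH : IsStronglyPEmbedded p H) {a x : G} (ha : a ∈ H)
    (hap : orderOf a = p) (hxa : Commute x a) : x ∈ H := by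
  by_contra hx
  have hmem : a ∈ H ⊓ Subgroup.map (MulAut.conj x).toMonoidHom H :=
    ⟨ha, a, ha, by simp [hxa.eq]⟩
  have hdvd := Subgroup.orderOf_dvd_natCard _ hmem
  rw [hap] at hdvd
  exact hp.one_lt.ne' ((hH.2.2 x hx).symm.eq_one_of_dvd hdvd)

/-- If a strongly `p`-embedded subgroup of `G₁ × G₂` contains an element `(a, 1)` with `a` of
order `p`, then it contains `1 × G₂`. -/
theorem IsStronglyPEmbedded.one_mk_mem {p : ℕ} (hp : p.Prime) {G₁ G₂ : Type*} [Group G₁]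
    [Group G₂] {H : Subgroup (G₁ × G₂)} (hH : IsStronglyPEmbedded p H) {a : G₁}
    (ha : (a, 1) ∈ H) (hap : orderOf a = p) (y : G₂) : (1, y) ∈ H :=
  hH.mem_of_commute hp ha (by simp [Prod.orderOf_mk, hap])
    (Commute.prod (Commute.one_left a) (Commute.one_right y))

/-- If a strongly `p`-embedded subgroup of `G₁ × G₂` contains an element `(1, b)` with `b` of
order `p`, then it contains `G₁ × 1`. -/
theorem IsStronglyPEmbedded.mk_one_mem {p : ℕ} (hp : p.Prime) {G₁ G₂ : Type*} [Group G₁]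
    [Group G₂] {H : Subgroup (G₁ × G₂)} (hH : IsStronglyPEmbedded p H) {b : G₂}
    (hb : (1, b) ∈ H) (hbp : orderOf b = p) (x : G₁) : (x, 1) ∈ H :=
  hH.mem_of_commute hp hb (by simp [Prod.orderOf_mk, hbp])
    (Commute.prod (Commute.one_right x) (Commute.one_left b))

theorem no_strongly_p_embedded_in_product
    (p : ℕ) (hp : p.Prime) (G₁ G₂ : Type*) [Group G₁] [Group G₂] [Finite G₁] [Finite G₂]
    (h₁ : p ∣ Nat.card G₁) (h₂ : p ∣ Nat.card G₂) :
    ∀ H : Subgroup (G₁ × G₂), ¬ IsStronglyPEmbedded p H := by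
  intro H hH
  have : Fact p.Prime := ⟨hp⟩
  obtain ⟨c₁, hc₁⟩ := exists_prime_orderOf_dvd_card' p h₁
  obtain ⟨c₂, hc₂⟩ := exists_prime_orderOf_dvd_card' p h₂
  obtain ⟨⟨⟨a₁, a₂⟩, ha⟩, hap⟩ := exists_prime_orderOf_dvd_card' p hH.2.1
  rw [Subgroup.orderOf_mk] at hap
  have hfactors : (∀ x : G₁, (x, 1) ∈ H) ∧ ∀ y : G₂, (1, y) ∈ H := by
    by_cases h : a₁ = 1
    · subst h
      have hleft := hH.mk_one_mem hp ha (by simpa [Prod.orderOf_mk] using hap)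
      exact ⟨hleft, hH.one_mk_mem hp (hleft c₁) hc₁⟩
    · have ha₁ : orderOf a₁ = p :=
        orderOf_eq_prime (congrArg Prod.fst (orderOf_dvd_iff_pow_eq_one.mp hap.dvd)) h
      have hmem : (a₁, 1) ∈ H :=
        hH.mem_of_commute hp ha hap (Commute.prod (Commute.refl a₁) (Commute.one_left a₂))
      have hright := hH.one_mk_mem hp hmem ha₁
      exact ⟨hH.mk_one_mem hp (hright c₂) hc₂, hright⟩
  refine hH.1.ne (eq_top_iff.mpr fun g _ => ?_)
  simpa using H.mul_mem (hfactors.1 g.1) (hfactors.2 g.2)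
end

section
/- Let G₁, G₂ be groups and S₁ ≤ G₁, S₂ ≤ G₂ nontrivial subgroups, and set S = S₁ × S₂ ≤ G₁ × G₂. Then the subgroup of G₁ × G₂ generated by the set {x ∈ G₁ × G₂ : xSx⁻¹ ∩ S ≠ 1} is all of G₁ × G₂. -/
theorem Subgroup.map_conj_inf_ne_bot_of_commute {G : Type*} [Group G] {S : Subgroup G} {x s : G}
    (hs : s ∈ S) (hs1 : s ≠ 1) (h : Commute x s) :
    Subgroup.map (MulAut.conj x).toMonoidHom S ⊓ S ≠ ⊥ := by
  refine Subgroup.ne_bot_iff_exists_ne_one.2 ⟨⟨s, ⟨s, hs, ?_⟩, hs⟩, ?_⟩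
  · simp [h.eq]
  · exact fun h1 => hs1 (congrArg Subtype.val h1)

theorem closure_conjugates_meeting_product_subgroup_eq_top
    (G₁ G₂ : Type*) [Group G₁] [Group G₂]
    (S₁ : Subgroup G₁) (S₂ : Subgroup G₂) (h₁ : S₁ ≠ ⊥) (h₂ : S₂ ≠ ⊥) :
    Subgroup.closure {x : G₁ × G₂ |
        Subgroup.map (MulAut.conj x).toMonoidHom (S₁.prod S₂) ⊓ S₁.prod S₂ ≠ ⊥} = ⊤ := by
  obtain ⟨s₁, hs₁, hne₁⟩ := S₁.bot_or_exists_ne_one.resolve_left h₁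
  obtain ⟨s₂, hs₂, hne₂⟩ := S₂.bot_or_exists_ne_one.resolve_left h₂
  refine (Subgroup.eq_top_iff' _).2 fun ⟨a, b⟩ => ?_
  rw [← Prod.fst_mul_snd (a, b)]
  refine mul_mem (Subgroup.subset_closure ?_) (Subgroup.subset_closure ?_)
  · exact Subgroup.map_conj_inf_ne_bot_of_commute (s := (1, s₂))
      ⟨S₁.one_mem, hs₂⟩ (by simpa using hne₂) (by simp [Prod.commute_iff])
  · exact Subgroup.map_conj_inf_ne_bot_of_commute (s := (s₁, 1))
      ⟨hs₁, S₂.one_mem⟩ (by simpa using hne₁) (by simp [Prod.commute_iff])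
end

section
/- Let p be a prime, G₀ a finite group, and W = G₀ ≀ C_p the wreath product. For every nontrivial subgroup Q ≤ G₀, the centralizer of Q ≀ C_p in W equals the diagonal image of the centralizer of Q in G₀: C_W(Q ≀ C_p) = Δ(C_{G₀}(Q)). -/
/-- The cyclic shift automorphism of `∏_{i ∈ ℤ/p} G₀` by `k`: `(σ_k g) i = g (i - k)`. -/
def shiftAut (p : ℕ) (G₀ : Type*) [Group G₀] (k : ZMod p) :
    (ZMod p → G₀) ≃* (ZMod p → G₀) where
  toFun g i := g (i - k)
  invFun g i := g (i + k)
  left_inv g := by funext i; simp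
  right_inv g := by funext i; simp
  map_mul' g h := rfl

/-- The action of `C_p = ℤ/p` (written multiplicatively) on the base group by cyclic shifts. -/
def shiftHom (p : ℕ) (G₀ : Type*) [Group G₀] :
    Multiplicative (ZMod p) →* MulAut (ZMod p → G₀) where
  toFun k := shiftAut p G₀ k.toAdd
  map_one' := by
    ext g i
    simp [shiftAut]
  map_mul' k l := by
    ext g i
    simp [shiftAut, sub_sub]

/-- The wreath product `G₀ ≀ C_p = (∏_{i ∈ ℤ/p} G₀) ⋊ C_p`. -/
abbrev WreathCp (p : ℕ) (G₀ : Type*) [Group G₀] :=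
  (ZMod p → G₀) ⋊[shiftHom p G₀] Multiplicative (ZMod p)

/-- The canonical generator `c` of the acting cyclic group `C_p` inside `G₀ ≀ C_p`. -/
def cGen (p : ℕ) (G₀ : Type*) [Group G₀] : WreathCp p G₀ :=
  SemidirectProduct.inr (Multiplicative.ofAdd (1 : ZMod p))

/-- For `Q ≤ G₀`, the subgroup `Q^p = ∏_{i ∈ ℤ/p} Q` of the base group. -/
def piSub (p : ℕ) {G₀ : Type*} [Group G₀] (Q : Subgroup G₀) : Subgroup (ZMod p → G₀) :=
  Subgroup.pi Set.univ fun _ => Q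

/-- For `Q ≤ G₀`, the subgroup `Q^p` viewed inside the wreath product `G₀ ≀ C_p`. -/
def baseSub (p : ℕ) {G₀ : Type*} [Group G₀] (Q : Subgroup G₀) : Subgroup (WreathCp p G₀) :=
  (piSub p Q).map SemidirectProduct.inl

/-- For `Q ≤ G₀`, the subgroup `Q ≀ C_p` of `G₀ ≀ C_p`, generated by `Q^p` and `c`. -/
def wrSub (p : ℕ) {G₀ : Type*} [Group G₀] (Q : Subgroup G₀) : Subgroup (WreathCp p G₀) :=
  baseSub p Q ⊔ Subgroup.zpowers (cGen p G₀)

/-- The diagonal embedding `Δ : G₀ → ∏_{i ∈ ℤ/p} G₀`. -/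
def diagHom (p : ℕ) (G₀ : Type*) [Group G₀] : G₀ →* (ZMod p → G₀) :=
  Pi.monoidHom fun _ => MonoidHom.id G₀

/-- The diagonal embedding `Δ : G₀ → G₀ ≀ C_p`. -/
def diagW (p : ℕ) (G₀ : Type*) [Group G₀] : G₀ →* WreathCp p G₀ :=
  SemidirectProduct.inl.comp (diagHom p G₀)

theorem mem_centralizer_wrSub_iff {p : ℕ} {G₀ : Type*} [Group G₀] {Q : Subgroup G₀}
    {w : WreathCp p G₀} :
    w ∈ Subgroup.centralizer (wrSub p Q : Set (WreathCp p G₀)) ↔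
      (∀ q : ZMod p → G₀, (∀ i, q i ∈ Q) → Commute (SemidirectProduct.inl q) w) ∧
        Commute (cGen p G₀) w := by
  have h : w ∈ Subgroup.centralizer (wrSub p Q : Set (WreathCp p G₀)) ↔
      wrSub p Q ≤ Subgroup.centralizer {w} := by
    simp only [Subgroup.mem_centralizer_iff, SetLike.le_def, Set.mem_singleton_iff, forall_eq,
      SetLike.mem_coe]
    exact forall₂_congr fun _ _ => eq_comm
  rw [h, wrSub, sup_le_iff, Subgroup.zpowers_le, baseSub, Subgroup.map_le_iff_le_comap]
  simp only [SetLike.le_def, Subgroup.mem_comap, Subgroup.mem_centralizer_singleton_iff, piSub,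
    Subgroup.mem_pi, Set.mem_univ, true_imp_iff, Commute, SemiconjBy]

theorem commute_cGen_iff {p : ℕ} {G₀ : Type*} [Group G₀] {w : WreathCp p G₀} :
    Commute (cGen p G₀) w ↔ ∀ i, w.left (i - 1) = w.left i := by
  rw [Commute, SemiconjBy, SemidirectProduct.ext_iff, SemidirectProduct.mul_left,
    SemidirectProduct.mul_left, SemidirectProduct.mul_right, SemidirectProduct.mul_right,
    cGen, SemidirectProduct.left_inr, SemidirectProduct.right_inr]
  simp [mul_comm, funext_iff, shiftHom, shiftAut]

theorem commute_inl_iff {p : ℕ} {G₀ : Type*} [Group G₀] {w : WreathCp p G₀}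
    {q : ZMod p → G₀} :
    Commute (SemidirectProduct.inl q) w ↔
      ∀ i, q i * w.left i = w.left i * q (i - w.right.toAdd) := by
  rw [Commute, SemiconjBy, SemidirectProduct.ext_iff, SemidirectProduct.mul_left,
    SemidirectProduct.mul_left, SemidirectProduct.mul_right, SemidirectProduct.mul_right,
    SemidirectProduct.left_inl, SemidirectProduct.right_inl]
  simp [funext_iff, shiftHom, shiftAut]

theorem eq_apply_zero_of_sub_one {p : ℕ} [NeZero p] {α : Type*} {f : ZMod p → α}
    (hf : ∀ i, f (i - 1) = f i) (i : ZMod p) : f i = f 0 := by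
  have h (n : ℕ) : f n = f 0 := by
    induction n with
    | zero => simp
    | succ n ih => rw [← hf, Nat.cast_succ, add_sub_cancel_right, ih]
  simpa using h i.val

theorem centralizer_wreath_eq_diag_centralizer
    (p : ℕ) (hp : p.Prime) (G₀ : Type*) [Group G₀] [Finite G₀]
    (Q : Subgroup G₀) (hQ : Q ≠ ⊥) :
    Subgroup.centralizer ((wrSub p Q : Subgroup (WreathCp p G₀)) : Set (WreathCp p G₀)) =
      (Subgroup.centralizer (Q : Set G₀)).map (diagW p G₀) := by
  have : NeZero p := ⟨hp.ne_zero⟩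
  ext w
  rw [mem_centralizer_wrSub_iff, commute_cGen_iff]
  simp only [commute_inl_iff, Subgroup.mem_map, Subgroup.mem_centralizer_iff, SetLike.mem_coe]
  constructor
  · rintro ⟨hbase, hc⟩
    have hright : w.right.toAdd = 0 := by
      by_contra hk
      obtain ⟨x, hx, hx1⟩ := Q.bot_or_exists_ne_one.resolve_left hQ
      refine hx1 ?_
      have h := hbase (Pi.mulSingle 0 x) (fun i => ?_) 0
      · simpa [Pi.mulSingle_apply, hk] using h
      · rw [Pi.mulSingle_apply]
        split_ifs
        exacts [hx, Q.one_mem]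
    refine ⟨w.left 0, fun q hq => hbase (fun _ => q) (fun _ => hq) 0, ?_⟩
    ext i
    · exact (eq_apply_zero_of_sub_one hc i).symm
    · exact hright.symm
  · rintro ⟨g, hg, rfl⟩
    refine ⟨fun q hq i => ?_, fun _ => rfl⟩
    change q i * g = g * q (i - 0)
    simpa using hg (q i) (hq i)
end
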